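/- Under the G₁-Assumption, the rows of Y satisfy: q_iᵀY = e_iᵀ (the i-th row of the k×k identity, viewed in ℝ^{1×k}) for 1 ≤ i ≤ k; q_iᵀY = 0 for k < i ≤ m; consequently min_{i≤k}‖q_iᵀY‖₂ = 1 and δ_k(Y) = max_{i>k}‖q_iᵀY‖₂ = max_{i>m}‖q_iᵀY‖₂. -/

import Mathlib

open Matrix

namespace ARR

/-- Euclidean norm of the `i`-th row of a matrix. -/
noncomputable def rowNorm {R C : Type*} [Fintype C] (M : Matrix R C ℝ) (i : R) : ℝ :=
  Real.sqrt (∑ j, M i j ^ 2)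

/-- Supremum of `f` over indices satisfying `P`. -/
noncomputable def supOver {n : ℕ} (P : Fin n → Prop) (f : Fin n → ℝ) : ℝ :=
  sSup (f '' {i | P i})

/-- Infimum of `f` over indices satisfying `P`. -/
noncomputable def infOver {n : ℕ} (P : Fin n → Prop) (f : Fin n → ℝ) : ℝ :=
  sInf (f '' {i | P i})

/-- The accuracy measure `δₖ(Z) = max_{i>k} ‖qᵢᵀZ‖ / min_{i≤k} ‖qᵢᵀZ‖`
(indices are 1-based in the paper; here `i > k` means `k ≤ i` for 0-based `i`). -/
noncomputable def deltaK {n k : ℕ} (Q : Matrix (Fin n) (Fin n) ℝ)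
    (Z : Matrix (Fin n) (Fin k) ℝ) : ℝ :=
  supOver (fun i => k ≤ (i : ℕ)) (rowNorm (Qᵀ * Z)) /
    infOver (fun i => (i : ℕ) < k) (rowNorm (Qᵀ * Z))

/-- `Γ_{k,m}(M) = max_{i>m} ‖eᵢᵀM‖ / min_{i≤k} ‖eᵢᵀM‖`. -/
noncomputable def gammaKM {n : ℕ} {C : Type*} [Fintype C] (k m : ℕ)
    (M : Matrix (Fin n) C ℝ) : ℝ :=
  supOver (fun i => m ≤ (i : ℕ)) (rowNorm M) / infOver (fun i => (i : ℕ) < k) (rowNorm M)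

/-- Spectral (operator 2-) norm of a matrix. -/
noncomputable def specNorm {a b : Type*} [Fintype a] [Fintype b] [DecidableEq b]
    (M : Matrix a b ℝ) : ℝ :=
  ‖LinearMap.toContinuousLinearMap (Matrix.toEuclideanLin M)‖

/-- The Vandermonde matrix `V` with `V i j = λᵢ^j`, `0 ≤ j ≤ p`. -/
def vand {n : ℕ} (lam : Fin n → ℝ) (p : ℕ) : Matrix (Fin n) (Fin (p + 1)) ℝ :=
  fun i j => lam i ^ (j : ℕ)

/-- The diagonal of `D`: `Dᵢᵢ = ‖qᵢᵀX‖₂ ⬝ ‖eᵢᵀV‖₂` (the norm of the `i`-th row of `Ĝ`). -/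
noncomputable def dvec {n k : ℕ} (lam : Fin n → ℝ) (p : ℕ) (Q : Matrix (Fin n) (Fin n) ℝ)
    (X : Matrix (Fin n) (Fin k) ℝ) : Fin n → ℝ :=
  fun i => rowNorm (Qᵀ * X) i * rowNorm (vand lam p) i

/-- `G = D† Ĝ`, where `Ĝ = [QᵀX, ΛQᵀX, …, ΛᵖQᵀX]`; the column block index is `j.1`. -/
noncomputable def gmat {n k : ℕ} (lam : Fin n → ℝ) (p : ℕ) (Q : Matrix (Fin n) (Fin n) ℝ)
    (X : Matrix (Fin n) (Fin k) ℝ) : Matrix (Fin n) (Fin (p + 1) × Fin k) ℝ :=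
  fun i j => (dvec lam p Q X i)⁻¹ * (lam i ^ (j.1 : ℕ) * (Qᵀ * X) i j.2)

/-- The augmented matrix `X_p = [X, AX, …, AᵖX]`; the column block index is `j.1`. -/
noncomputable def aug {n k : ℕ} (A : Matrix (Fin n) (Fin n) ℝ)
    (X : Matrix (Fin n) (Fin k) ℝ) (p : ℕ) : Matrix (Fin n) (Fin (p + 1) × Fin k) ℝ :=
  fun i j => (A ^ (j.1 : ℕ) * X) i j.2

/-- First `m` rows of a matrix. -/
def topRows {n : ℕ} {C : Type*} (m : ℕ) (hmn : m ≤ n) (M : Matrix (Fin n) C ℝ) :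
    Matrix (Fin m) C ℝ :=
  fun i j => M (Fin.castLE hmn i) j

/-- Last `n - m` rows of a matrix. -/
def lowRows {n : ℕ} {C : Type*} (m : ℕ) (hmn : m ≤ n) (M : Matrix (Fin n) C ℝ) :
    Matrix (Fin (n - m)) C ℝ :=
  fun i j => M ⟨m + (i : ℕ), by have := i.isLt; omega⟩ j

/-- First `m` columns of a square matrix (`Q_m`). -/
def colsTop {n : ℕ} (m : ℕ) (hmn : m ≤ n) (M : Matrix (Fin n) (Fin n) ℝ) :
    Matrix (Fin n) (Fin m) ℝ :=
  fun i j => M i (Fin.castLE hmn j)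

/-- Last `n - m` columns of a square matrix (`Q_{m+}`). -/
def colsLow {n : ℕ} (m : ℕ) (hmn : m ≤ n) (M : Matrix (Fin n) (Fin n) ℝ) :
    Matrix (Fin n) (Fin (n - m)) ℝ :=
  fun i j => M i ⟨m + (j : ℕ), by have := j.isLt; omega⟩

/-- `E_k`: the first `k` columns of the `m × m` identity matrix. -/
def ekMat (m k : ℕ) : Matrix (Fin m) (Fin k) ℝ :=
  fun i j => if (i : ℕ) = (j : ℕ) then 1 else 0

/-- `D₁⁻¹`: the inverse of the leading `m × m` block of `D`. -/
noncomputable def d1inv {n : ℕ} (m : ℕ) (hmn : m ≤ n) (d : Fin n → ℝ) :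
    Matrix (Fin m) (Fin m) ℝ :=
  Matrix.diagonal fun i => (d (Fin.castLE hmn i))⁻¹

/-- `D₂`: the trailing `(n-m) × (n-m)` block of `D`. -/
noncomputable def d2mat {n : ℕ} (m : ℕ) (hmn : m ≤ n) (d : Fin n → ℝ) :
    Matrix (Fin (n - m)) (Fin (n - m)) ℝ :=
  Matrix.diagonal fun i => d ⟨m + (i : ℕ), by have := i.isLt; omega⟩

/-- `Y = X_p G₁† D₁⁻¹ E_k`, where `A = Q Λ Qᵀ` and `X_p = [X, AX, …, AᵖX]`. -/
noncomputable def ymat {n k : ℕ} (m : ℕ) (hmn : m ≤ n) (lam : Fin n → ℝ) (p : ℕ)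
    (Q : Matrix (Fin n) (Fin n) ℝ) (X : Matrix (Fin n) (Fin k) ℝ)
    (Gpinv : Matrix (Fin (p + 1) × Fin k) (Fin m) ℝ) : Matrix (Fin n) (Fin k) ℝ :=
  aug (Q * Matrix.diagonal lam * Qᵀ) X p * Gpinv * d1inv m hmn (dvec lam p Q X) * ekMat m k

end ARR

namespace ARR

theorem transpose_mul_conj_diagonal_pow {n : ℕ} (lam : Fin n → ℝ)
    (Q : Matrix (Fin n) (Fin n) ℝ) (hQ' : Qᵀ * Q = 1) (r : ℕ) :
    Qᵀ * (Q * diagonal lam * Qᵀ) ^ r = diagonal lam ^ r * Qᵀ := by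
  induction r with
  | zero => simp
  | succ r ih =>
    rw [pow_succ, ← Matrix.mul_assoc, ih, pow_succ]
    calc diagonal lam ^ r * Qᵀ * (Q * diagonal lam * Qᵀ)
        = diagonal lam ^ r * (Qᵀ * Q) * diagonal lam * Qᵀ := by
          simp only [Matrix.mul_assoc]
      _ = diagonal lam ^ r * diagonal lam * Qᵀ := by rw [hQ', Matrix.mul_one]

theorem transpose_mul_aug_apply {n k : ℕ} (lam : Fin n → ℝ) (p : ℕ)
    (Q : Matrix (Fin n) (Fin n) ℝ) (hQ' : Qᵀ * Q = 1) (X : Matrix (Fin n) (Fin k) ℝ)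
    (i : Fin n) (c : Fin (p + 1) × Fin k) :
    (Qᵀ * aug (Q * diagonal lam * Qᵀ) X p) i c =
      lam i ^ (c.1 : ℕ) * (Qᵀ * X) i c.2 := by
  have h : (Qᵀ * aug (Q * diagonal lam * Qᵀ) X p) i c =
      (Qᵀ * ((Q * diagonal lam * Qᵀ) ^ (c.1 : ℕ) * X)) i c.2 := rfl
  rw [h, ← Matrix.mul_assoc, transpose_mul_conj_diagonal_pow lam Q hQ', Matrix.mul_assoc,
    diagonal_pow, diagonal_mul, Pi.pow_apply]

theorem transpose_mul_ymat_castLE {n k p m : ℕ} (hmn : m ≤ n) (lam : Fin n → ℝ)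
    (Q : Matrix (Fin n) (Fin n) ℝ) (hQ' : Qᵀ * Q = 1) (X : Matrix (Fin n) (Fin k) ℝ)
    (Gpinv : Matrix (Fin (p + 1) × Fin k) (Fin m) ℝ)
    (hG1 : topRows m hmn (gmat lam p Q X) * Gpinv = 1) (i : Fin m) (j : Fin k) :
    (Qᵀ * ymat m hmn lam p Q X Gpinv) (Fin.castLE hmn i) j = ekMat m k i j := by
  have hd : dvec lam p Q X (Fin.castLE hmn i) ≠ 0 := by
    intro h
    have h1 := congrFun (congrFun hG1 i) i
    simp [Matrix.mul_apply, topRows, gmat, h] at h1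
  have hrow (l : Fin m) :
      (Qᵀ * aug (Q * diagonal lam * Qᵀ) X p * Gpinv) (Fin.castLE hmn i) l =
        dvec lam p Q X (Fin.castLE hmn i) * (1 : Matrix (Fin m) (Fin m) ℝ) i l := by
    rw [← hG1, Matrix.mul_apply, Matrix.mul_apply, Finset.mul_sum]
    refine Finset.sum_congr rfl fun c _ => ?_
    rw [transpose_mul_aug_apply lam p Q hQ', topRows, gmat]
    field_simp
  have hassoc : Qᵀ * ymat m hmn lam p Q X Gpinv =
      Qᵀ * aug (Q * diagonal lam * Qᵀ) X p * Gpinv *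
        d1inv m hmn (dvec lam p Q X) * ekMat m k := by
    simp only [ymat, Matrix.mul_assoc]
  rw [hassoc, Matrix.mul_apply, Finset.sum_eq_single i]
  · rw [d1inv, mul_diagonal, hrow, one_apply_eq, mul_one, mul_inv_cancel₀ hd, one_mul]
  · intro l _ hl
    rw [d1inv, mul_diagonal, hrow, one_apply_ne hl.symm]
    simp
  · simp

theorem rowNorm_nonneg {R C : Type*} [Fintype C] (M : Matrix R C ℝ) (i : R) :
    0 ≤ rowNorm M i :=
  Real.sqrt_nonneg _

theorem infOver_eq_of_forall_eq {n : ℕ} {P : Fin n → Prop} {f : Fin n → ℝ} {a : ℝ}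
    (hP : ∃ i, P i) (h : ∀ i, P i → f i = a) : infOver P f = a := by
  obtain ⟨i, hi⟩ := hP
  have himage : f '' {i | P i} = {a} := by
    ext x
    constructor
    · rintro ⟨l, hl, rfl⟩
      exact h l hl
    · rintro rfl
      exact ⟨i, hi, h i hi⟩
  rw [infOver, himage, csInf_singleton]

theorem supOver_eq_of_eq_zero {n : ℕ} {P P' : Fin n → Prop} {f : Fin n → ℝ}
    (hf : ∀ i, 0 ≤ f i) (hne : ∃ i, P' i) (hsub : ∀ i, P' i → P i)
    (hzero : ∀ i, P i → ¬ P' i → f i = 0) : supOver P f = supOver P' f := by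
  have hbdd (S : Fin n → Prop) : BddAbove (f '' {i | S i}) := (Set.toFinite _).bddAbove
  obtain ⟨i₀, hi₀⟩ := hne
  apply le_antisymm
  · refine csSup_le ⟨f i₀, i₀, hsub i₀ hi₀, rfl⟩ ?_
    rintro _ ⟨i, hi, rfl⟩
    by_cases hi' : P' i
    · exact le_csSup (hbdd P') ⟨i, hi', rfl⟩
    · rw [hzero i hi hi']
      exact (hf i₀).trans (le_csSup (hbdd P') ⟨i₀, hi₀, rfl⟩)
  · exact csSup_le_csSup (hbdd P) ⟨f i₀, i₀, hi₀, rfl⟩ (Set.image_mono hsub)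

end ARR

open ARR in
/-- rows of `Y` in the proof of Lemma 3.2. Under the `G₁`-Assumption,
`qᵢᵀY = eᵢᵀ` for `i ≤ k` (1-based), `qᵢᵀY = 0` for `k < i ≤ m`; consequently
`min_{i≤k}‖qᵢᵀY‖ = 1` and `δₖ(Y) = max_{i>k}‖qᵢᵀY‖ = max_{i>m}‖qᵢᵀY‖`.
(Here indices are 0-based: `i ≤ k` becomes `(i:ℕ) < k`, etc.) -/
theorem arr_rows_of_Y {n k p m : ℕ} (hk : 0 < k) (hn : (p + 1) * k < n)
    (hkm : k ≤ m) (hmk : m ≤ k + p * k) (hmn : m ≤ n)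
    (lam : Fin n → ℝ) (hlam : Antitone lam)
    (Q : Matrix (Fin n) (Fin n) ℝ) (hQ : Q * Qᵀ = 1) (hQ' : Qᵀ * Q = 1)
    (X : Matrix (Fin n) (Fin k) ℝ)
    (Gpinv : Matrix (Fin (p + 1) × Fin k) (Fin m) ℝ)
    (hG1 : topRows m hmn (gmat lam p Q X) * Gpinv = 1) :
    (∀ i : Fin n, (i : ℕ) < k → ∀ j : Fin k,
        (Qᵀ * ymat m hmn lam p Q X Gpinv) i j = if (i : ℕ) = (j : ℕ) then 1 else 0) ∧
      (∀ i : Fin n, k ≤ (i : ℕ) → (i : ℕ) < m → ∀ j : Fin k,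
        (Qᵀ * ymat m hmn lam p Q X Gpinv) i j = 0) ∧
      infOver (fun i => (i : ℕ) < k) (rowNorm (Qᵀ * ymat m hmn lam p Q X Gpinv)) = 1 ∧
      deltaK Q (ymat m hmn lam p Q X Gpinv) =
        supOver (fun i => k ≤ (i : ℕ)) (rowNorm (Qᵀ * ymat m hmn lam p Q X Gpinv)) ∧
      supOver (fun i => k ≤ (i : ℕ)) (rowNorm (Qᵀ * ymat m hmn lam p Q X Gpinv)) =
        supOver (fun i => m ≤ (i : ℕ)) (rowNorm (Qᵀ * ymat m hmn lam p Q X Gpinv)) := by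
  have hrows (i : Fin n) (hi : (i : ℕ) < m) (j : Fin k) :
      (Qᵀ * ymat m hmn lam p Q X Gpinv) i j = if (i : ℕ) = (j : ℕ) then 1 else 0 :=
    transpose_mul_ymat_castLE hmn lam Q hQ' X Gpinv hG1 ⟨i, hi⟩ j
  have hzero (i : Fin n) (hki : k ≤ (i : ℕ)) (him : (i : ℕ) < m) (j : Fin k) :
      (Qᵀ * ymat m hmn lam p Q X Gpinv) i j = 0 := by
    rw [hrows i him j, if_neg (by have := j.isLt; omega)]
  have hmlt : m < n := by
    have : (p + 1) * k = k + p * k := by ring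
    omega
  have hinf : infOver (fun i => (i : ℕ) < k)
      (rowNorm (Qᵀ * ymat m hmn lam p Q X Gpinv)) = 1 := by
    refine infOver_eq_of_forall_eq ⟨⟨0, by omega⟩, hk⟩ fun i hi => ?_
    rw [rowNorm, Finset.sum_eq_single ⟨i, hi⟩]
    · rw [hrows i (by omega)]
      simp
    · intro j _ hj
      rw [hrows i (by omega), if_neg fun h => hj (Fin.ext h.symm)]
      simp
    · simp
  refine ⟨fun i hi => hrows i (by omega), hzero, hinf, ?_, ?_⟩
  · rw [deltaK, hinf, div_one]
  · refine supOver_eq_of_eq_zero (rowNorm_nonneg _) ⟨⟨m, hmlt⟩, le_rfl⟩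
      (fun i hi => hkm.trans hi) fun i hi hi' => ?_
    simp [rowNorm, hzero i hi (not_le.mp hi')]
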